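/- Let n ≥ 2, β ≥ 0, 0 ≤ ε < 1, C₀ > 1 and let χ be a cutoff. Assume α satisfies one of: (i) (n−3)/2 + ε < β < (n−1)/2 and α ≤ 2β − (n−3)/2 − ε; or (ii) β ≥ (n−1)/2 and α < β + 1 − ε. Then there exist constants C > 0 and γ > 0 (γ possibly depending on β) such that for every θ ∈ S^{n−1}, every r > 0 and every Schwartz function q on ℝⁿ, ‖ k^ε · S̃_{θ,r}(q) ‖_{L²_α} ≤ C (1+r)^{−γ} ‖q‖²_{W^{β,2}_1}, where (k^ε · S̃_{θ,r}(q))(η) := k(η,θ)^ε χ(η) S_{θ,r}(q)(η) for η ∈ H_θ and := 0 for η ∉ H_θ. -/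

import Mathlib

open MeasureTheory Real Filter Set Metric
open scoped FourierTransform RealInnerProductSpace SchwartzMap ENNReal

noncomputable section

abbrev En (n : ℕ) := EuclideanSpace ℝ (Fin n)

/-- Japanese bracket `⟨x⟩ = (1+|x|²)^{1/2}`. -/
def jap {n : ℕ} (x : En n) : ℝ := Real.sqrt (1 + ‖x‖ ^ 2)

/-- `k(η,θ) = -|η|²/(θ·η)`. -/
def kval {n : ℕ} (θ η : En n) : ℝ := -‖η‖ ^ 2 / ⟪θ, η⟫

/-- The Ewald sphere `Γ_r(-2kθ)`, of center `-kθ` and radius `rk`. -/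
def ewald {n : ℕ} (θ η : En n) (r : ℝ) : Set (En n) :=
  Metric.sphere (-(kval θ η • θ)) (r * kval θ η)

/-- The spherical operator `S_{θ,r}`. -/
def Sop {n : ℕ} (θ : En n) (r : ℝ) (q : En n → ℂ) (η : En n) : ℂ :=
  if ⟪η, θ⟫ < 0 then
    ((kval θ η * (r + 1))⁻¹ : ℝ) •
      ∫ ξ in ewald θ η r, 𝓕 q ξ * 𝓕 q (η - ξ) ∂μH[(n : ℝ) - 1]
  else 0

/-- The operator `K_r(g₁,g₂)`. -/
def Kop {n : ℕ} {G₁ G₂ : Type*} [NormedAddCommGroup G₁] [NormedAddCommGroup G₂]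
    (θ : En n) (r : ℝ) (g₁ : En n → G₁) (g₂ : En n → G₂) (η : En n) : ℝ :=
  if ⟪η, θ⟫ < 0 then
    (kval θ η)⁻¹ * ∫ ξ in ewald θ η r, ‖g₁ ξ‖ * ‖g₂ (η - ξ)‖ ∂μH[(n : ℝ) - 1]
  else 0

/-- Weighted norm `‖F‖_{L²_α}`. -/
def L2w {n : ℕ} {G : Type*} [NormedAddCommGroup G] (α : ℝ) (F : En n → G) : ℝ :=
  (∫ η, jap η ^ (2 * α) * ‖F η‖ ^ 2) ^ (1/2 : ℝ)

/-- Weighted Sobolev norm `‖q‖_{W^{β,2}_δ} = ‖⟨·⟩^δ 𝓕⁻¹(⟨·⟩^β 𝓕q)‖_{L²}`. -/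
def sobNorm {n : ℕ} (β δ : ℝ) (q : En n → ℂ) : ℝ :=
  (∫ x, jap x ^ (2 * δ) * ‖𝓕⁻ (fun ξ => (jap ξ ^ β : ℝ) • 𝓕 q ξ) x‖ ^ 2) ^ (1/2 : ℝ)

/-- A smooth radial cutoff vanishing for `|ξ| < C₀` and equal to `1` for `|ξ| > 2C₀`. -/
structure IsCutoff {n : ℕ} (C₀ : ℝ) (χ : En n → ℝ) : Prop where
  smooth : ContDiff ℝ (⊤ : ℕ∞) χ
  mem_Icc : ∀ ξ, χ ξ ∈ Set.Icc (0 : ℝ) 1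
  eq_one : ∀ ξ : En n, 2 * C₀ < ‖ξ‖ → χ ξ = 1
  eq_zero : ∀ ξ : En n, ‖ξ‖ < C₀ → χ ξ = 0


/-! ### Part 1: spheres and coordinate projections -/

/-- Forget the `i`-th coordinate. -/
def prj {m : ℕ} (i : Fin (m + 1)) (x : En (m + 1)) : Fin m → ℝ := fun j => x (i.succAbove j)

lemma continuous_prj {m : ℕ} (i : Fin (m + 1)) : Continuous (prj i) := by
  unfold prj; fun_prop

lemma map_prj_le {m : ℕ} (i : Fin (m + 1)) (P : Set (En (m + 1)))
    (L : NNReal)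
    (h : ∀ x ∈ P, ∀ y ∈ P, dist x y ≤ L * dist (prj i x) (prj i y)) :
    Measure.map (prj i) ((μH[(m : ℝ)] : Measure (En (m + 1))).restrict P)
      ≤ ((L : ℝ≥0∞) ^ m) • (volume : Measure (Fin m → ℝ)) := by
  rw [Measure.le_iff]
  intro s hs
  rw [Measure.map_apply (continuous_prj i).measurable hs,
    Measure.restrict_apply ((continuous_prj i).measurable hs)]
  set Q := prj i ⁻¹' s ∩ P with hQ
  have hinj : InjOn (prj i) Q := by
    intro x hx y hy hxy
    have := h x hx.2 y hy.2
    rw [hxy, dist_self, mul_zero] at this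
    exact dist_le_zero.1 this
  have himg : Function.invFunOn (prj i) Q '' (prj i '' Q) = Q := by
    rw [← image_comp]
    have : ∀ x ∈ Q, (Function.invFunOn (prj i) Q ∘ prj i) x = id x := by
      intro x hx
      exact hinj.leftInvOn_invFunOn hx
    rw [image_congr this, image_id]
  have hlip : LipschitzOnWith L (Function.invFunOn (prj i) Q) (prj i '' Q) := by
    apply LipschitzOnWith.of_dist_le_mul
    rintro _ ⟨x, hx, rfl⟩ _ ⟨y, hy, rfl⟩
    rw [hinj.leftInvOn_invFunOn hx, hinj.leftInvOn_invFunOn hy]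
    exact h x hx.2 y hy.2
  have h1 := hlip.hausdorffMeasure_image_le (d := (m : ℝ)) (by positivity)
  rw [himg] at h1
  refine h1.trans ?_
  rw [Measure.smul_apply, smul_eq_mul, ENNReal.rpow_natCast]
  gcongr
  have h2 : (μH[(m : ℝ)] : Measure (Fin m → ℝ)) = volume := by
    have := hausdorffMeasure_pi_real (ι := Fin m)
    rwa [Fintype.card_fin] at this
  rw [h2]
  rintro _ ⟨x, hx, rfl⟩
  exact hx.1

lemma lintegral_prj_le {m : ℕ} (i : Fin (m + 1)) (P : Set (En (m + 1)))
    (L : NNReal)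
    (h : ∀ x ∈ P, ∀ y ∈ P, dist x y ≤ L * dist (prj i x) (prj i y))
    (f : (Fin m → ℝ) → ℝ≥0∞) (hf : Measurable f) :
    ∫⁻ x in P, f (prj i x) ∂μH[(m : ℝ)] ≤ (L : ℝ≥0∞) ^ m * ∫⁻ y, f y := by
  rw [← lintegral_map hf (continuous_prj i).measurable]
  refine (lintegral_mono' (map_prj_le i P L h) le_rfl).trans ?_
  rw [lintegral_smul_measure, smul_eq_mul]

/-- pieces of the sphere -/
def pce {m : ℕ} (c : En (m + 1)) (R : ℝ) (a : Fin (m + 1) × Bool) : Set (En (m + 1)) :=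
  {x | x ∈ sphere c R ∧ R ≤ (m + 1) * ((if a.2 then 1 else -1) * (x a.1 - c a.1))}

/-- Lipschitz constant -/
def Lc (m : ℕ) : NNReal := (m : NNReal) + m * (m + 1)

lemma abs_coord_le {k : ℕ} (u : En k) (j : Fin k) : |u j| ≤ ‖u‖ := by
  simpa using PiLp.norm_apply_le u j

lemma norm_le_sum_abs {k : ℕ} (u : En k) : ‖u‖ ≤ ∑ j, |u j| := by
  rw [EuclideanSpace.norm_eq]
  apply Real.sqrt_le_iff.2
  refine ⟨Finset.sum_nonneg fun _ _ => abs_nonneg _, ?_⟩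
  simp only [Real.norm_eq_abs]
  exact Finset.sum_sq_le_sq_sum_of_nonneg (fun _ _ => abs_nonneg _)

lemma sphere_subset_pce {m : ℕ} (c : En (m + 1)) (R : ℝ) :
    sphere c R ⊆ ⋃ a, pce c R a := by
  intro x hx
  have h1 : R ≤ ∑ j, |x j - c j| := by
    have := norm_le_sum_abs (x - c)
    rw [mem_sphere_iff_norm.1 hx] at this
    simpa using this
  obtain ⟨i, hi⟩ : ∃ i, R ≤ (m + 1) * |x i - c i| := by
    by_contra! hcon
    have : (m + 1 : ℝ) * ∑ j, |x j - c j| < ∑ j : Fin (m + 1), R := by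
      rw [Finset.mul_sum]
      exact Finset.sum_lt_sum_of_nonempty (by simp) (fun i _ => hcon i)
    simp at this
    have h3 : (0 : ℝ) < m + 1 := by positivity
    nlinarith
  simp only [mem_iUnion]
  rcases abs_cases (x i - c i) with h | h
  · exact ⟨(i, true), hx, by simpa [h.1] using hi⟩
  · refine ⟨(i, false), hx, ?_⟩
    rw [h.1] at hi
    simpa using hi

lemma pce_anti {m : ℕ} (c : En (m + 1)) (R : ℝ) (hR : 0 < R) (a : Fin (m + 1) × Bool) :
    ∀ x ∈ pce c R a, ∀ y ∈ pce c R a, dist x y ≤ Lc m * dist (prj a.1 x) (prj a.1 y) := by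
  obtain ⟨i, b⟩ := a
  rintro x ⟨hx, hx'⟩ y ⟨hy, hy'⟩
  simp only at hx' hy' ⊢
  set d := dist (prj i x) (prj i y) with hd
  have hd0 : 0 ≤ d := dist_nonneg
  have hj : ∀ j : Fin m, |x (i.succAbove j) - y (i.succAbove j)| ≤ d := by
    intro j
    have := dist_le_pi_dist (prj i x) (prj i y) j
    rwa [Real.dist_eq] at this
  have hxn := mem_sphere_iff_norm.1 hx
  have hyn := mem_sphere_iff_norm.1 hy
  have hxc : ∀ j, |x j - c j| ≤ R := fun j => by
    have := abs_coord_le (x - c) j; rw [hxn] at this; simpa using this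
  have hyc : ∀ j, |y j - c j| ≤ R := fun j => by
    have := abs_coord_le (y - c) j; rw [hyn] at this; simpa using this
  have hsx : ∑ j, (x j - c j) ^ 2 = R ^ 2 := by
    rw [← hxn, EuclideanSpace.real_norm_sq_eq]; simp
  have hsy : ∑ j, (y j - c j) ^ 2 = R ^ 2 := by
    rw [← hyn, EuclideanSpace.real_norm_sq_eq]; simp
  rw [Fin.sum_univ_succAbove _ i] at hsx hsy
  have key : |(x i - c i) ^ 2 - (y i - c i) ^ 2| ≤ m * (d * (2 * R)) := by
    have e : (x i - c i) ^ 2 - (y i - c i) ^ 2 =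
        ∑ j : Fin m, ((y (i.succAbove j) - c (i.succAbove j)) ^ 2
          - (x (i.succAbove j) - c (i.succAbove j)) ^ 2) := by
      rw [Finset.sum_sub_distrib]; linarith
    rw [e]
    refine (Finset.abs_sum_le_sum_abs _ _).trans ?_
    have : ∀ j ∈ (Finset.univ : Finset (Fin m)), |(y (i.succAbove j) - c (i.succAbove j)) ^ 2
          - (x (i.succAbove j) - c (i.succAbove j)) ^ 2| ≤ d * (2 * R) := by
      intro j _
      have e2 : (y (i.succAbove j) - c (i.succAbove j)) ^ 2
          - (x (i.succAbove j) - c (i.succAbove j)) ^ 2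
          = -(x (i.succAbove j) - y (i.succAbove j)) *
          ((y (i.succAbove j) - c (i.succAbove j)) + (x (i.succAbove j) - c (i.succAbove j))) := by
        ring
      rw [e2, abs_mul, abs_neg]
      refine mul_le_mul (hj j) ?_ (abs_nonneg _) hd0
      exact (abs_add_le _ _).trans (by linarith [hxc (i.succAbove j), hyc (i.succAbove j)])
    refine (Finset.sum_le_sum this).trans ?_
    simp
  have hxi : |x i - y i| ≤ m * (m + 1) * d := by
    have e3 : (x i - c i) ^ 2 - (y i - c i) ^ 2 = (x i - y i) * ((x i - c i) + (y i - c i)) := by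
      ring
    rw [e3, abs_mul] at key
    have h4 : 2 * R ≤ (m + 1) * |(x i - c i) + (y i - c i)| := by
      cases b
      · simp at hx' hy'
        have := neg_abs_le ((x i - c i) + (y i - c i))
        have h3 : (0 : ℝ) < m + 1 := by positivity
        nlinarith
      · simp at hx' hy'
        have := le_abs_self ((x i - c i) + (y i - c i))
        have h3 : (0 : ℝ) < m + 1 := by positivity
        nlinarith
    have h5 : |x i - y i| * (2 * R) ≤ (m * (m + 1) * d) * (2 * R) := by
      calc |x i - y i| * (2 * R) ≤ |x i - y i| * ((m + 1) * |(x i - c i) + (y i - c i)|) := by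
            gcongr
        _ = (m + 1) * (|x i - y i| * |(x i - c i) + (y i - c i)|) := by ring
        _ ≤ (m + 1) * (m * (d * (2 * R))) := by gcongr
        _ = _ := by ring
    exact le_of_mul_le_mul_right h5 (by positivity)
  rw [dist_eq_norm]
  refine (norm_le_sum_abs _).trans ?_
  rw [Fin.sum_univ_succAbove _ i]
  have : ∑ j : Fin m, |(x - y) (i.succAbove j)| ≤ m * d := by
    refine (Finset.sum_le_sum (fun j _ => (by simpa using hj j :
      |(x - y) (i.succAbove j)| ≤ d))).trans ?_
    simp
  have e6 : |(x - y) i| = |x i - y i| := by simp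
  rw [e6]
  simp only [Lc]
  push_cast
  nlinarith

lemma lintegral_sphere_le {m : ℕ} (c : En (m + 1)) (R : ℝ) (f : En (m + 1) → ℝ≥0∞) :
    ∫⁻ x in sphere c R, f x ∂μH[(m : ℝ)] ≤
      ∑ a, ∫⁻ x in pce c R a, f x ∂μH[(m : ℝ)] := by
  refine (lintegral_mono_set (sphere_subset_pce c R)).trans ?_
  refine (lintegral_iUnion_le _ _).trans ?_
  rw [tsum_fintype]

/-! ### Part 2: trace inequality -/

lemma enorm_le_lintegral_deriv (f f' : ℝ → ℝ) (hf : ∀ t, HasDerivAt f (f' t) t)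
    (hc : Continuous f') (h0 : Tendsto f atBot (nhds 0)) (x : ℝ) :
    ‖f x‖ₑ ≤ ∫⁻ t, ‖f' t‖ₑ := by
  by_cases hfint : Integrable f'
  · have h1 := integral_Iic_of_hasDerivAt_of_tendsto' (a := x) (fun t _ => hf t)
      hfint.integrableOn h0
    rw [sub_zero] at h1
    rw [← h1]
    exact (enorm_integral_le_lintegral_enorm _).trans (setLIntegral_le_lintegral _ _)
  · have : ∫⁻ t, ‖f' t‖ₑ = ⊤ := by
      by_contra hne
      exact hfint ⟨hc.aestronglyMeasurable, lt_top_iff_ne_top.2 hne⟩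
    rw [this]; exact le_top

/-- insert a coordinate -/
def ins {m : ℕ} (i : Fin (m + 1)) (p : ℝ × (Fin m → ℝ)) : En (m + 1) :=
  WithLp.toLp 2 (i.insertNth p.1 p.2)

lemma ins_prj {m : ℕ} (i : Fin (m + 1)) (x : En (m + 1)) : ins i (x i, prj i x) = x := by
  ext j
  rcases Fin.eq_self_or_eq_succAbove i j with h | ⟨k, h⟩
  · subst h; simp [ins]
  · subst h; simp [ins, prj]

lemma ins_eq {m : ℕ} (i : Fin (m + 1)) (t : ℝ) (y : Fin m → ℝ) :
    ins i (t, y) = ins i (0, y) + t • EuclideanSpace.single i (1 : ℝ) := by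
  ext j
  rcases Fin.eq_self_or_eq_succAbove i j with h | ⟨k, h⟩
  · subst h; simp [ins]
  · subst h; simp [ins]

lemma continuous_ins {m : ℕ} (i : Fin (m + 1)) : Continuous (ins (m := m) i) := by
  unfold ins
  refine (PiLp.continuous_toLp 2 _).comp ?_
  exact Continuous.finInsertNth i continuous_fst continuous_snd

lemma mp_ins {m : ℕ} (i : Fin (m + 1)) : MeasurePreserving (ins (m := m) i) := by
  have h1 := (volume_preserving_piFinSuccAbove (fun _ : Fin (m + 1) => ℝ) i).symm _
  have h2 := PiLp.volume_preserving_toLp (Fin (m + 1))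
  exact h2.comp h1

lemma trace_pce {m : ℕ} (c : En (m + 1)) (R : ℝ) (hR : 0 < R) (a : Fin (m + 1) × Bool)
    (F : En (m + 1) → ℝ) (hF : ContDiff ℝ 1 F) (h0 : Tendsto F (cocompact _) (nhds 0)) :
    ∫⁻ x in pce c R a, ‖F x‖ₑ ∂μH[(m : ℝ)] ≤
      (Lc m : ℝ≥0∞) ^ m * ∫⁻ x, ‖fderiv ℝ F x (EuclideanSpace.single a.1 (1 : ℝ))‖ₑ := by
  set i := a.1 with hi
  set e : En (m + 1) := EuclideanSpace.single i (1 : ℝ) with he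
  set F' : En (m + 1) → ℝ := fun x => fderiv ℝ F x e with hF'
  have hF'c : Continuous F' := (hF.continuous_fderiv one_ne_zero).clm_apply continuous_const
  set M : (Fin m → ℝ) → ℝ≥0∞ := fun y => ∫⁻ t : ℝ, ‖F' (ins i (t, y))‖ₑ with hM
  have hmeas : Measurable fun p : ℝ × (Fin m → ℝ) => ‖F' (ins i p)‖ₑ :=
    (hF'c.comp (continuous_ins i)).enorm.measurable
  have hMm : Measurable M := hmeas.lintegral_prod_left'
  have hpt : ∀ x, ‖F x‖ₑ ≤ M (prj i x) := by
    intro x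
    have := enorm_le_lintegral_deriv (fun t => F (ins i (t, prj i x)))
      (fun t => F' (ins i (t, prj i x))) ?_ ?_ ?_ (x i)
    · rwa [ins_prj] at this
    · intro t
      have h1 : HasDerivAt (fun t => ins i (t, prj i x)) e t := by
        have : (fun t => ins i (t, prj i x)) = fun t => ins i (0, prj i x) + t • e := by
          funext t; exact ins_eq i t _
        rw [this]
        simpa using ((hasDerivAt_id t).smul_const e).const_add (ins i (0, prj i x))
      exact ((hF.differentiable one_ne_zero _).hasFDerivAt).comp_hasDerivAt t h1
    · exact hF'c.comp ((continuous_ins i).comp (by fun_prop))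
    · refine h0.comp ?_
      rw [← Metric.cobounded_eq_cocompact, ← tendsto_norm_atTop_iff_cobounded]
      refine tendsto_atTop_mono (f := fun t : ℝ => |t|) ?_ tendsto_abs_atBot_atTop
      intro t
      have := abs_coord_le (ins i (t, prj i x)) i
      simpa [ins] using this
  calc ∫⁻ x in pce c R a, ‖F x‖ₑ ∂μH[(m : ℝ)]
      ≤ ∫⁻ x in pce c R a, M (prj i x) ∂μH[(m : ℝ)] := lintegral_mono hpt
    _ ≤ (Lc m : ℝ≥0∞) ^ m * ∫⁻ y, M y := lintegral_prj_le i _ _ (pce_anti c R hR a) M hMm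
    _ = _ := by
      congr 1
      rw [← (mp_ins i).lintegral_comp hF'c.enorm.measurable, Measure.volume_eq_prod,
        lintegral_prod_symm _ hmeas.aemeasurable]

/-! ### Part 3: a Riesz potential bound on spheres -/

lemma jap_pos {n : ℕ} (x : En n) : 0 < jap x := by unfold jap; positivity

lemma one_le_jap {n : ℕ} (x : En n) : 1 ≤ jap x := by
  unfold jap; rw [Real.one_le_sqrt]; nlinarith [sq_nonneg ‖x‖]

lemma norm_le_jap {n : ℕ} (x : En n) : ‖x‖ ≤ jap x := by
  unfold jap; apply Real.le_sqrt_of_sq_le; linarith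

lemma continuous_jap {n : ℕ} : Continuous (jap (n := n)) := by
  unfold jap; fun_prop

lemma jap_sq {n : ℕ} (x : En n) : jap x ^ 2 = 1 + ‖x‖ ^ 2 := by
  unfold jap; rw [Real.sq_sqrt]; positivity

lemma ennreal_rpow_neg_anti {a b : ℝ≥0∞} {p : ℝ} (hp : 0 ≤ p) (hab : a ≤ b) :
    b ^ (-p) ≤ a ^ (-p) := by
  rw [ENNReal.rpow_neg, ENNReal.rpow_neg, ENNReal.inv_le_inv]
  exact ENNReal.rpow_le_rpow hab hp

lemma ofReal_rpow_neg_le {a b p : ℝ} (hb : 0 < b) (hab : a ≤ b) (hp : 0 ≤ p) :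
    ENNReal.ofReal (b ^ (-p)) ≤ (ENNReal.ofReal a) ^ (-p) := by
  rw [← ENNReal.ofReal_rpow_of_pos hb]
  exact ennreal_rpow_neg_anti hp (ENNReal.ofReal_le_ofReal hab)

lemma riesz_unit (m : ℕ) (hm : 1 ≤ m) (p : ℝ) (hpm : p < m) :
    ∫⁻ z in ball (0 : Fin m → ℝ) 1, ‖z‖ₑ ^ (-p) ≠ ⊤ := by
  have : Nonempty (Fin m) := ⟨⟨0, hm⟩⟩
  have h := integrableOn_ball_of_norm_le_rpow (μ := (volume : Measure (Fin m → ℝ)))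
    (f := fun z : Fin m → ℝ => ‖z‖ ^ (-p)) (C := 1) (α := p) (r := 1) (by simpa using hm)
    (by simpa using hpm) (by
      filter_upwards with z
      rw [one_mul, Real.norm_of_nonneg (by positivity)])
    (by apply Measurable.aestronglyMeasurable; fun_prop)
  have h2 := h.2
  rw [hasFiniteIntegral_iff_enorm] at h2
  refine ne_of_lt (lt_of_le_of_lt (le_of_eq ?_) h2)
  apply lintegral_congr_ae
  apply ae_restrict_of_ae
  have : ∀ᵐ z : Fin m → ℝ, z ≠ 0 := by
    simp [ae_iff]
  filter_upwards [this] with z hz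
  have hz' : 0 < ‖z‖ := norm_pos_iff.2 hz
  rw [Real.enorm_eq_ofReal (by positivity), ← ENNReal.ofReal_rpow_of_pos hz', ofReal_norm]

lemma riesz_ball (m : ℕ) (p R : ℝ) (hR : 0 < R) (b : Fin m → ℝ) :
    ∫⁻ y in ball b R, ‖y - b‖ₑ ^ (-p) =
      ENNReal.ofReal (R ^ ((m : ℝ) - p)) * ∫⁻ z in ball (0 : Fin m → ℝ) 1, ‖z‖ₑ ^ (-p) := by
  set f : (Fin m → ℝ) → ℝ≥0∞ := (ball (0 : Fin m → ℝ) R).indicator (fun y => ‖y‖ₑ ^ (-p)) with hf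
  have hfm : Measurable f := Measurable.indicator (by fun_prop) measurableSet_ball
  have h1 : ∫⁻ y in ball b R, ‖y - b‖ₑ ^ (-p) = ∫⁻ y, f y := by
    rw [← lintegral_sub_right_eq_self f b, ← lintegral_indicator measurableSet_ball]
    congr 1
    funext y
    simp only [hf, indicator, mem_ball, dist_eq_norm, sub_zero]
  have h2 := Measure.map_addHaar_smul (volume : Measure (Fin m → ℝ)) hR.ne'
  have h3 : ∫⁻ z, f (R • z) = ENNReal.ofReal |(R ^ m)⁻¹| * ∫⁻ y, f y := by
    rw [← lintegral_map hfm (by fun_prop), h2, lintegral_smul_measure]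
    simp
  have h4 : ∫⁻ z, f (R • z) = ENNReal.ofReal (R ^ (-p)) *
      ∫⁻ z in ball (0 : Fin m → ℝ) 1, ‖z‖ₑ ^ (-p) := by
    rw [← lintegral_const_mul _ (by fun_prop), ← lintegral_indicator measurableSet_ball]
    congr 1
    funext z
    have e1 : R • z ∈ ball (0 : Fin m → ℝ) R ↔ z ∈ ball (0 : Fin m → ℝ) 1 := by
      simp [norm_smul, abs_of_pos hR, hR]
    by_cases hz : z ∈ ball (0 : Fin m → ℝ) 1
    · rw [hf, indicator_of_mem (e1.2 hz), indicator_of_mem hz, enorm_smul,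
        ENNReal.mul_rpow_of_ne_top (by simp) (by simp), Real.enorm_eq_ofReal hR.le,
        ENNReal.ofReal_rpow_of_pos hR]
    · rw [hf, indicator_of_notMem (fun h => hz (e1.1 h)), indicator_of_notMem hz]
  rw [h1]
  have h5 : ENNReal.ofReal (R ^ m) * ENNReal.ofReal |(R ^ m)⁻¹| = 1 := by
    rw [← ENNReal.ofReal_mul (by positivity), abs_of_pos (by positivity),
      mul_inv_cancel₀ (by positivity), ENNReal.ofReal_one]
  calc ∫⁻ y, f y = ENNReal.ofReal (R ^ m) * (ENNReal.ofReal |(R ^ m)⁻¹| * ∫⁻ y, f y) := by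
        rw [← mul_assoc, h5, one_mul]
    _ = _ := by
      rw [← h3, h4, ← mul_assoc, ← ENNReal.ofReal_mul (by positivity), sub_eq_add_neg,
        Real.rpow_add hR, Real.rpow_natCast]

lemma riesz_closedBall (m : ℕ) (hm : 1 ≤ m) (p : ℝ) (hp : 0 ≤ p) (hpm : p < m) :
    ∃ K : ℝ≥0∞, K ≠ ⊤ ∧ ∀ R : ℝ, 0 < R → ∀ a b : Fin m → ℝ,
      ∫⁻ y in closedBall a R, ‖y - b‖ₑ ^ (-p) ≤ K * ENNReal.ofReal (R ^ ((m : ℝ) - p)) := by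
  refine ⟨(∫⁻ z in ball (0 : Fin m → ℝ) 1, ‖z‖ₑ ^ (-p)) + ENNReal.ofReal (2 ^ m),
    ENNReal.add_ne_top.2 ⟨riesz_unit m hm p hpm, by simp⟩, ?_⟩
  intro R hR a b
  have hpt : ∀ y, ‖y - b‖ₑ ^ (-p) ≤
      (ball b R).indicator (fun y => ‖y - b‖ₑ ^ (-p)) y + ENNReal.ofReal (R ^ (-p)) := by
    intro y
    by_cases hy : y ∈ ball b R
    · rw [indicator_of_mem hy]; exact le_self_add
    · rw [indicator_of_notMem hy, zero_add, ← ENNReal.ofReal_rpow_of_pos hR]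
      apply ennreal_rpow_neg_anti hp
      rw [← ofReal_norm]
      apply ENNReal.ofReal_le_ofReal
      rw [mem_ball, dist_eq_norm] at hy
      linarith
  calc ∫⁻ y in closedBall a R, ‖y - b‖ₑ ^ (-p)
      ≤ ∫⁻ y in closedBall a R, ((ball b R).indicator (fun y => ‖y - b‖ₑ ^ (-p)) y
          + ENNReal.ofReal (R ^ (-p))) := lintegral_mono hpt
    _ = (∫⁻ y in closedBall a R, (ball b R).indicator (fun y => ‖y - b‖ₑ ^ (-p)) y)
          + ENNReal.ofReal (R ^ (-p)) * volume (closedBall a R) := by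
        rw [lintegral_add_right _ measurable_const, setLIntegral_const]
    _ ≤ (∫⁻ y in ball b R, ‖y - b‖ₑ ^ (-p))
          + ENNReal.ofReal (R ^ (-p)) * volume (closedBall a R) := by
        refine add_le_add ?_ le_rfl
        rw [← lintegral_indicator measurableSet_ball]
        exact setLIntegral_le_lintegral _ _
    _ = _ := by
        rw [riesz_ball m p R hR b, Real.volume_pi_closedBall _ hR.le,
          ← ENNReal.ofReal_mul (by positivity), add_mul, mul_comm (ENNReal.ofReal _),
          ← ENNReal.ofReal_mul (by positivity)]
        congr 2
        rw [Fintype.card_fin, sub_eq_add_neg, Real.rpow_add hR, Real.rpow_natCast]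
        ring

lemma isClosed_pce {m : ℕ} (c : En (m + 1)) (R : ℝ) (a : Fin (m + 1) × Bool) :
    IsClosed (pce c R a) := by
  apply IsClosed.inter isClosed_sphere
  have : Continuous fun x : En (m + 1) =>
      ((m : ℝ) + 1) * ((if a.2 then 1 else -1) * (x a.1 - c a.1)) := by fun_prop
  exact isClosed_le continuous_const this

lemma norm_prj_le {m : ℕ} (i : Fin (m + 1)) (x y : En (m + 1)) :
    ‖prj i x - prj i y‖ ≤ ‖x - y‖ := by
  rw [pi_norm_le_iff_of_nonneg (norm_nonneg _)]
  intro j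
  simpa [prj] using abs_coord_le (x - y) (i.succAbove j)

lemma riesz_sphere (m : ℕ) (hm : 1 ≤ m) (p : ℝ) (hp : 0 ≤ p) (hpm : p < m) :
    ∃ K : ℝ≥0∞, K ≠ ⊤ ∧ ∀ R : ℝ, 0 < R → ∀ c x : En (m + 1),
      ∫⁻ ξ in sphere c R, ENNReal.ofReal (jap (ξ - x) ^ (-p)) ∂μH[(m : ℝ)]
        ≤ K * ENNReal.ofReal (R ^ ((m : ℝ) - p)) := by
  obtain ⟨K, hK, h⟩ := riesz_closedBall m hm p hp hpm
  refine ⟨∑ a : Fin (m + 1) × Bool, (Lc m : ℝ≥0∞) ^ m * K, ?_, ?_⟩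
  · refine (ENNReal.sum_lt_top.2 fun a _ => ?_).ne
    exact ENNReal.mul_lt_top (ENNReal.pow_lt_top ENNReal.coe_lt_top) hK.lt_top
  intro R hR c x
  refine (lintegral_sphere_le c R _).trans ?_
  rw [Finset.sum_mul]
  refine Finset.sum_le_sum fun a _ => ?_
  set f : (Fin m → ℝ) → ℝ≥0∞ :=
    (closedBall (prj a.1 c) R).indicator (fun y => ‖y - prj a.1 x‖ₑ ^ (-p)) with hf
  have hfm : Measurable f := Measurable.indicator (by fun_prop) measurableSet_closedBall
  calc ∫⁻ ξ in pce c R a, ENNReal.ofReal (jap (ξ - x) ^ (-p)) ∂μH[(m : ℝ)]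
      ≤ ∫⁻ ξ in pce c R a, f (prj a.1 ξ) ∂μH[(m : ℝ)] := by
        refine setLIntegral_mono' (isClosed_pce c R a).measurableSet ?_
        intro ξ hξ
        have hmem : prj a.1 ξ ∈ closedBall (prj a.1 c) R := by
          rw [mem_closedBall, dist_eq_norm]
          exact (norm_prj_le _ _ _).trans (mem_sphere_iff_norm.1 hξ.1).le
        rw [hf, indicator_of_mem hmem, ← ofReal_norm]
        exact ofReal_rpow_neg_le (jap_pos _)
          ((norm_prj_le _ _ _).trans (norm_le_jap _)) hp
    _ ≤ (Lc m : ℝ≥0∞) ^ m * ∫⁻ y, f y := lintegral_prj_le a.1 _ _ (pce_anti c R hR a) f hfm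
    _ ≤ (Lc m : ℝ≥0∞) ^ m * (K * ENNReal.ofReal (R ^ ((m : ℝ) - p))) := by
        gcongr
        rw [hf, lintegral_indicator measurableSet_closedBall]
        exact h R hR _ _
    _ = _ := by rw [mul_assoc]

/-! ### Part 4: Plancherel -/

lemma jap_rpow {n : ℕ} (x : En n) (s : ℝ) : jap x ^ s = (1 + ‖x‖ ^ 2) ^ (s / 2) := by
  unfold jap
  rw [Real.sqrt_eq_rpow, ← Real.rpow_mul (by positivity)]
  congr 1; ring

lemma exists_schwartz_weight {n : ℕ} (β : ℝ) (q : 𝓢(En n, ℂ)) :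
    ∃ g : 𝓢(En n, ℂ), ∀ ξ, g ξ = (jap ξ ^ β : ℝ) • 𝓕 (⇑q) ξ := by
  have hT : (fun x : En n => ((1 + ‖x‖ ^ 2) ^ (β / 2) : ℝ)).HasTemperateGrowth := by fun_prop
  refine ⟨SchwartzMap.smulLeftCLM ℂ (fun x : En n => ((1 + ‖x‖ ^ 2) ^ (β / 2) : ℝ)) (𝓕 q), ?_⟩
  intro ξ
  rw [SchwartzMap.smulLeftCLM_apply_apply hT, jap_rpow, SchwartzMap.fourier_coe]

lemma integrable_norm_sq_schwartz {n : ℕ} (u : 𝓢(En n, ℂ)) :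
    Integrable (fun x => ‖u x‖ ^ 2) :=
  (memLp_two_iff_integrable_sq_norm u.continuous.aestronglyMeasurable).1 (u.memLp 2)

lemma lintegral_enorm_sq_schwartz {n : ℕ} (u : 𝓢(En n, ℂ)) :
    ∫⁻ x, ‖u x‖ₑ ^ 2 = ENNReal.ofReal (∫ x, ‖u x‖ ^ 2) := by
  rw [ofReal_integral_eq_lintegral_ofReal (integrable_norm_sq_schwartz u)
    (Eventually.of_forall fun x => by positivity)]
  congr 1; funext x
  rw [ENNReal.ofReal_pow (norm_nonneg _), ofReal_norm]

open scoped LineDeriv in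
lemma plancherel_bounds {n : ℕ} (β : ℝ) (q g : 𝓢(En n, ℂ))
    (hg : ∀ ξ, g ξ = (jap ξ ^ β : ℝ) • 𝓕 (⇑q) ξ) :
    (∫⁻ x, ‖g x‖ₑ ^ 2 ≤ ENNReal.ofReal (sobNorm β 1 (⇑q) ^ 2)) ∧
    ∀ i : Fin n, ∫⁻ x, ‖fderiv ℝ g x (EuclideanSpace.single i (1:ℝ))‖ₑ ^ 2 ≤
      ENNReal.ofReal ((2 * π) ^ 2) * ENNReal.ofReal (sobNorm β 1 (⇑q) ^ 2) := by
  set u : 𝓢(En n, ℂ) := 𝓕⁻ g with hu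
  have hFu : 𝓕 u = g := by rw [hu]; exact FourierTransform.fourier_fourierInv_eq g
  have hcoe : 𝓕⁻ (fun ξ => (jap ξ ^ β : ℝ) • 𝓕 (⇑q) ξ) = ⇑u := by
    rw [hu, SchwartzMap.fourierInv_coe]
    congr 1
    funext ξ; exact (hg ξ).symm
  have hT : (fun x : En n => ((1 + ‖x‖ ^ 2) ^ ((1:ℝ) / 2) : ℝ)).HasTemperateGrowth := by fun_prop
  set w : 𝓢(En n, ℂ) :=
    SchwartzMap.smulLeftCLM ℂ (fun x : En n => ((1 + ‖x‖ ^ 2) ^ ((1:ℝ) / 2) : ℝ)) u with hw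
  have hwx : ∀ x, ‖w x‖ ^ 2 = (1 + ‖x‖ ^ 2) * ‖u x‖ ^ 2 := by
    intro x
    rw [hw, SchwartzMap.smulLeftCLM_apply_apply hT, norm_smul, mul_pow,
      Real.norm_of_nonneg (by positivity), ← Real.rpow_natCast, ← Real.rpow_mul (by positivity)]
    norm_num
  have hN : sobNorm β 1 (⇑q) ^ 2 = ∫ x, ‖w x‖ ^ 2 := by
    unfold sobNorm
    rw [hcoe, ← Real.rpow_natCast, ← Real.rpow_mul (by
      apply integral_nonneg; intro x
      have := jap_pos x
      positivity)]
    norm_num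
    congr 1; funext x
    rw [hwx, jap_sq]
  rw [hN, lintegral_enorm_sq_schwartz]
  constructor
  · apply ENNReal.ofReal_le_ofReal
    rw [← hFu, SchwartzMap.integral_norm_sq_fourier]
    apply integral_mono (integrable_norm_sq_schwartz u) (integrable_norm_sq_schwartz w)
    intro x
    simp only [hwx]
    nlinarith [mul_nonneg (sq_nonneg ‖x‖) (sq_nonneg ‖u x‖)]
  · intro i
    set e : En n := EuclideanSpace.single i (1:ℝ) with he
    have hTi : (fun x : En n => inner ℝ x e).HasTemperateGrowth := by fun_prop
    have h1 := SchwartzMap.lineDerivOp_fourier_eq u e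
    rw [hFu] at h1
    set v : 𝓢(En n, ℂ) := -(2 * π * Complex.I) • SchwartzMap.smulLeftCLM ℂ (inner ℝ · e) u with hv
    have h2 : ∫⁻ x, ‖fderiv ℝ g x e‖ₑ ^ 2 = ENNReal.ofReal (∫ x, ‖v x‖ ^ 2) := by
      rw [← SchwartzMap.integral_norm_sq_fourier, ← h1, ← lintegral_enorm_sq_schwartz]
      rfl
    rw [h2, ← ENNReal.ofReal_mul (by positivity)]
    apply ENNReal.ofReal_le_ofReal
    rw [← integral_const_mul]
    apply integral_mono (integrable_norm_sq_schwartz v)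
      ((integrable_norm_sq_schwartz w).const_mul _)
    intro x
    have hvx : v x = -(2 * π * Complex.I) • (inner ℝ x e) • u x := by
      rw [hv, smul_apply, SchwartzMap.smulLeftCLM_apply_apply hTi]
    have hin : |inner ℝ x e| ≤ ‖x‖ := by
      have := abs_real_inner_le_norm x e
      simpa [he] using this
    have hn : ‖v x‖ = 2 * π * (|inner ℝ x e| * ‖u x‖) := by
      rw [hvx, norm_smul, norm_smul]
      simp [abs_of_pos Real.pi_pos]
    simp only [hwx, hn]
    have : |inner ℝ x e| ^ 2 ≤ 1 + ‖x‖ ^ 2 := by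
      nlinarith [abs_nonneg (inner ℝ x e)]
    calc (2 * π * (|inner ℝ x e| * ‖u x‖)) ^ 2 = (2 * π) ^ 2 * (|inner ℝ x e| ^ 2 * ‖u x‖ ^ 2) := by
          ring
      _ ≤ _ := by gcongr

/-! ### Part 5: the trace bound and its integral in `η` -/

/-- Majorant of the derivative of `‖g‖²` in direction `i`. -/
def Dmaj {m : ℕ} (g : 𝓢(En (m + 1), ℂ)) (i : Fin (m + 1)) (x : En (m + 1)) : ℝ≥0∞ :=
  ‖g x‖ₑ ^ 2 + ‖fderiv ℝ g x (EuclideanSpace.single i (1:ℝ))‖ₑ ^ 2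

lemma measurable_Dmaj {m : ℕ} (g : 𝓢(En (m + 1), ℂ)) (i : Fin (m + 1)) :
    Measurable (Dmaj g i) := by
  have h1 : Continuous g := g.continuous
  have h2 : Continuous (fun x => fderiv ℝ g x (EuclideanSpace.single i (1:ℝ))) :=
    ((g.smooth 1).continuous_fderiv (by norm_num)).clm_apply continuous_const
  unfold Dmaj
  exact (h1.measurable.enorm.pow_const 2).add (h2.measurable.enorm.pow_const 2)

/-- Majorant of the spherical integral of `‖g(ξ)‖² ‖g(η-ξ)‖²`. -/
def Bmaj {m : ℕ} (g : 𝓢(En (m + 1), ℂ)) (η : En (m + 1)) : ℝ≥0∞ :=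
  ∑ a : Fin (m + 1) × Bool, (Lc m : ℝ≥0∞) ^ m *
    ∫⁻ ξ, (Dmaj g a.1 ξ * ‖g (η - ξ)‖ₑ ^ 2 + ‖g ξ‖ₑ ^ 2 * Dmaj g a.1 (η - ξ))

lemma abs_two_inner_le (a b : ℂ) : |2 * inner ℝ a b| ≤ ‖a‖ ^ 2 + ‖b‖ ^ 2 := by
  rw [abs_mul, abs_two]
  nlinarith [abs_real_inner_le_norm a b, sq_nonneg (‖a‖ - ‖b‖)]

lemma lintegral_sphere_conv_le {m : ℕ} (g : 𝓢(En (m + 1), ℂ)) (η c : En (m + 1)) (R : ℝ)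
    (hR : 0 < R) :
    ∫⁻ ξ in sphere c R, ‖g ξ‖ₑ ^ 2 * ‖g (η - ξ)‖ₑ ^ 2 ∂μH[(m : ℝ)] ≤ Bmaj g η := by
  refine (lintegral_sphere_le c R _).trans ?_
  refine Finset.sum_le_sum fun a _ => ?_
  set F : En (m + 1) → ℝ := fun ξ => ‖g ξ‖ ^ 2 * ‖g (η - ξ)‖ ^ 2 with hF
  have hgs : ContDiff ℝ 1 g := g.smooth 1
  have hgd : ∀ x, HasFDerivAt g (fderiv ℝ g x) x := fun x => g.differentiableAt.hasFDerivAt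
  have hFs : ContDiff ℝ 1 F :=
    (hgs.norm_sq ℝ).mul ((hgs.comp (contDiff_const.sub contDiff_id)).norm_sq ℝ)
  have hg0 : Tendsto g (cocompact _) (nhds 0) := g.toZeroAtInfty.zero_at_infty'
  have hg1 : Tendsto (fun ξ => g (η - ξ)) (cocompact _) (nhds 0) :=
    hg0.comp (Homeomorph.subLeft η).isClosedEmbedding.tendsto_cocompact
  have hF0 : Tendsto F (cocompact _) (nhds 0) := by
    have := (hg0.norm.pow 2).mul (hg1.norm.pow 2)
    simpa [hF] using this
  have ht := trace_pce c R hR a F hFs hF0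
  have hFe : ∀ ξ, ‖F ξ‖ₑ = ‖g ξ‖ₑ ^ 2 * ‖g (η - ξ)‖ₑ ^ 2 := by
    intro ξ; simp [hF, enorm_mul, enorm_pow]
  simp only [hFe] at ht
  refine ht.trans ?_
  gcongr with ξ
  set e : En (m + 1) := EuclideanSpace.single a.1 (1:ℝ) with he
  have hd2 : HasFDerivAt (fun ξ => g (η - ξ)) ((fderiv ℝ g (η - ξ)).comp
      (-(ContinuousLinearMap.id ℝ (En (m + 1))))) ξ :=
    (hgd (η - ξ)).comp ξ ((hasFDerivAt_id ξ).const_sub η)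
  have hd := (hgd ξ).norm_sq.mul hd2.norm_sq
  have hval : fderiv ℝ F ξ e = ‖g ξ‖ ^ 2 * (2 * inner ℝ (g (η - ξ)) (-(fderiv ℝ g (η - ξ) e)))
      + ‖g (η - ξ)‖ ^ 2 * (2 * inner ℝ (g ξ) (fderiv ℝ g ξ e)) := by
    rw [show fderiv ℝ F ξ = _ from hd.fderiv]
    simp
    ring
  have hb : ‖fderiv ℝ F ξ e‖ ≤ (‖g ξ‖ ^ 2 + ‖fderiv ℝ g ξ e‖ ^ 2) * ‖g (η - ξ)‖ ^ 2
      + ‖g ξ‖ ^ 2 * (‖g (η - ξ)‖ ^ 2 + ‖fderiv ℝ g (η - ξ) e‖ ^ 2) := by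
    rw [hval]
    refine (norm_add_le _ _).trans ?_
    rw [norm_mul (‖g ξ‖ ^ 2), norm_mul (‖g (η - ξ)‖ ^ 2), Real.norm_of_nonneg (sq_nonneg ‖g ξ‖),
      Real.norm_of_nonneg (sq_nonneg ‖g (η - ξ)‖), Real.norm_eq_abs, Real.norm_eq_abs]
    have h1 := abs_two_inner_le (g (η - ξ)) (-(fderiv ℝ g (η - ξ) e))
    have h2 := abs_two_inner_le (g ξ) (fderiv ℝ g ξ e)
    rw [norm_neg] at h1
    rw [add_comm, mul_comm (‖g (η - ξ)‖ ^ 2)]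
    gcongr
  have := ENNReal.ofReal_le_ofReal hb
  rw [ofReal_norm, ENNReal.ofReal_add (by positivity) (by positivity),
    ENNReal.ofReal_mul (by positivity), ENNReal.ofReal_mul (by positivity),
    ENNReal.ofReal_add (by positivity) (by positivity),
    ENNReal.ofReal_add (by positivity) (by positivity)] at this
  simp only [ENNReal.ofReal_pow (norm_nonneg _), ofReal_norm] at this
  exact this

lemma lintegral_conv {n : ℕ} (f g : En n → ℝ≥0∞) (hf : Measurable f) (hg : Measurable g) :
    ∫⁻ η, ∫⁻ ξ, f ξ * g (η - ξ) = (∫⁻ ξ, f ξ) * ∫⁻ ξ, g ξ := by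
  rw [lintegral_lintegral_swap (by fun_prop)]
  have : ∀ ξ, ∫⁻ η, f ξ * g (η - ξ) = f ξ * ∫⁻ η, g η := by
    intro ξ
    rw [lintegral_const_mul _ (by fun_prop), lintegral_sub_right_eq_self]
  simp only [this]
  rw [lintegral_mul_const _ hf]

lemma lintegral_Bmaj_le {m : ℕ} (g : 𝓢(En (m + 1), ℂ)) (N P : ℝ≥0∞)
    (h0 : ∫⁻ x, ‖g x‖ₑ ^ 2 ≤ N)
    (h1 : ∀ i, ∫⁻ x, ‖fderiv ℝ g x (EuclideanSpace.single i (1:ℝ))‖ₑ ^ 2 ≤ P * N) :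
    ∫⁻ η, Bmaj g η ≤
      (∑ _a : Fin (m + 1) × Bool, (Lc m : ℝ≥0∞) ^ m * (2 * (1 + P))) * N ^ 2 := by
  have hgm : Measurable g := g.continuous.measurable
  have hG : Measurable (fun x => ‖g x‖ₑ ^ 2) := by fun_prop
  have hDm := fun i => measurable_Dmaj g i
  have hD : ∀ i, ∫⁻ x, Dmaj g i x ≤ (1 + P) * N := by
    intro i
    unfold Dmaj
    rw [lintegral_add_left hG, add_mul, one_mul]
    exact add_le_add h0 (h1 i)
  unfold Bmaj
  have hm1 : ∀ i, Measurable (Function.uncurry fun η ξ : En (m + 1) =>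
      Dmaj g i ξ * ‖g (η - ξ)‖ₑ ^ 2) := by
    intro i; have := hDm i
    unfold Function.uncurry
    fun_prop
  have hm2 : ∀ i, Measurable (Function.uncurry fun η ξ : En (m + 1) =>
      ‖g ξ‖ₑ ^ 2 * Dmaj g i (η - ξ)) := by
    intro i; have := hDm i
    unfold Function.uncurry
    fun_prop
  have hsplit : ∀ (i : Fin (m + 1)) (η : En (m + 1)),
      ∫⁻ ξ, (Dmaj g i ξ * ‖g (η - ξ)‖ₑ ^ 2 + ‖g ξ‖ₑ ^ 2 * Dmaj g i (η - ξ)) =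
      (∫⁻ ξ, Dmaj g i ξ * ‖g (η - ξ)‖ₑ ^ 2) + ∫⁻ ξ, ‖g ξ‖ₑ ^ 2 * Dmaj g i (η - ξ) := by
    intro i η
    have := hDm i
    exact lintegral_add_left (by fun_prop) _
  simp only [hsplit]
  rw [lintegral_finsetSum _ (fun a _ => (((hm1 a.1).lintegral_prod_right).add
    ((hm2 a.1).lintegral_prod_right)).const_mul _), Finset.sum_mul]
  refine Finset.sum_le_sum fun a _ => ?_
  rw [lintegral_const_mul' _ _ (ENNReal.pow_lt_top ENNReal.coe_lt_top).ne, lintegral_add_left (hm1 a.1).lintegral_prod_right,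
    lintegral_conv _ _ (hDm a.1) hG, lintegral_conv _ _ hG (hDm a.1), mul_assoc]
  gcongr
  calc (∫⁻ ξ, Dmaj g a.1 ξ) * (∫⁻ ξ, ‖g ξ‖ₑ ^ 2) + (∫⁻ ξ, ‖g ξ‖ₑ ^ 2) * (∫⁻ ξ, Dmaj g a.1 ξ)
      ≤ ((1 + P) * N) * N + N * ((1 + P) * N) := by
        gcongr <;> exact hD _
    _ = _ := by ring

/-! ### Part 6: pointwise weights -/

lemma jap_add_le {n : ℕ} (x y : En n) : jap (x + y) ≤ jap x + jap y := by
  have hx := one_le_jap x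
  have hy := one_le_jap y
  have h1 := jap_sq (x + y)
  have h2 := jap_sq x
  have h3 := jap_sq y
  have h4 := norm_add_le x y
  have h5 : ‖x‖ * ‖y‖ ≤ jap x * jap y :=
    mul_le_mul (norm_le_jap x) (norm_le_jap y) (norm_nonneg _) (jap_pos x).le
  refine le_of_sq_le_sq ?_ (by linarith)
  have h6 : ‖x + y‖ ^ 2 ≤ (‖x‖ + ‖y‖) ^ 2 := by gcongr
  nlinarith

lemma jap_weight_aux {n : ℕ} (β p : ℝ) (hβ : 0 ≤ β) (hp : p ≤ 2 * β) (x y : En n)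
    (hxy : jap x ≤ jap y) :
    jap x ^ (-(2 * β)) * jap y ^ (-(2 * β)) ≤
      2 ^ (2 * β) * jap (x + y) ^ (-(2 * β)) * jap x ^ (-p) := by
  have hx := one_le_jap x
  have hxp := jap_pos x
  have hs := jap_pos (x + y)
  have h1 : jap (x + y) / 2 ≤ jap y := by linarith [jap_add_le x y]
  have h2 : jap y ^ (-(2 * β)) ≤ (jap (x + y) / 2) ^ (-(2 * β)) :=
    Real.rpow_le_rpow_of_nonpos (by positivity) h1 (by linarith)
  have h3 : (jap (x + y) / 2) ^ (-(2 * β)) = 2 ^ (2 * β) * jap (x + y) ^ (-(2 * β)) := by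
    rw [Real.div_rpow hs.le (by norm_num), Real.rpow_neg (by norm_num : (0:ℝ) ≤ 2), div_inv_eq_mul,
      mul_comm]
  have h4 : jap x ^ (-(2 * β)) ≤ jap x ^ (-p) := Real.rpow_le_rpow_of_exponent_le hx (by linarith)
  rw [h3] at h2
  rw [mul_comm]
  exact mul_le_mul h2 h4 (by positivity) (by positivity)

lemma jap_weight {n : ℕ} (β p : ℝ) (hβ : 0 ≤ β) (hp : p ≤ 2 * β) (η ξ : En n) :
    jap ξ ^ (-(2 * β)) * jap (η - ξ) ^ (-(2 * β)) ≤
      2 ^ (2 * β) * jap η ^ (-(2 * β)) * (jap (ξ - 0) ^ (-p) + jap (ξ - η) ^ (-p)) := by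
  have hxp := jap_pos ξ
  have hyp := jap_pos (η - ξ)
  have hs := jap_pos η
  have e1 : jap (ξ - η) = jap (η - ξ) := by unfold jap; rw [norm_sub_rev]
  rw [sub_zero, e1]
  rcases le_total (jap ξ) (jap (η - ξ)) with h | h
  · have := jap_weight_aux β p hβ hp ξ (η - ξ) h
    rw [add_sub_cancel] at this
    refine this.trans ?_
    gcongr
    exact le_add_of_nonneg_right (by positivity)
  · have := jap_weight_aux β p hβ hp (η - ξ) ξ h
    rw [sub_add_cancel, mul_comm (jap (η - ξ) ^ _)] at this
    refine this.trans ?_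
    gcongr
    exact le_add_of_nonneg_left (by positivity)

lemma sphere_weight (m : ℕ) (hm : 1 ≤ m) (β p : ℝ) (hβ : 0 ≤ β) (hp0 : 0 ≤ p) (hpm : p < m)
    (hp : p ≤ 2 * β) :
    ∃ K : ℝ≥0∞, K ≠ ⊤ ∧ ∀ R : ℝ, 0 < R → ∀ c η : En (m + 1),
      ∫⁻ ξ in sphere c R,
        ENNReal.ofReal (jap ξ ^ (-(2 * β)) * jap (η - ξ) ^ (-(2 * β))) ∂μH[(m : ℝ)]
        ≤ K * ENNReal.ofReal (jap η ^ (-(2 * β)) * R ^ ((m : ℝ) - p)) := by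
  obtain ⟨K, hK, h⟩ := riesz_sphere m hm p hp0 hpm
  refine ⟨ENNReal.ofReal (2 ^ (2 * β)) * (2 * K), ENNReal.mul_ne_top (by simp)
    (ENNReal.mul_ne_top (by simp) hK), ?_⟩
  intro R hR c η
  have hs := jap_pos η
  have hj : ∀ x : En (m + 1), 0 ≤ jap x ^ (-p) := fun x => (Real.rpow_pos_of_pos (jap_pos x) _).le
  have hms : Measurable fun ξ : En (m + 1) => ENNReal.ofReal (jap (ξ - 0) ^ (-p)) := by
    have : Measurable (jap (n := m + 1)) := continuous_jap.measurable
    fun_prop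
  calc ∫⁻ ξ in sphere c R,
        ENNReal.ofReal (jap ξ ^ (-(2 * β)) * jap (η - ξ) ^ (-(2 * β))) ∂μH[(m : ℝ)]
      ≤ ∫⁻ ξ in sphere c R, ENNReal.ofReal (2 ^ (2 * β) * jap η ^ (-(2 * β))) *
          (ENNReal.ofReal (jap (ξ - 0) ^ (-p)) + ENNReal.ofReal (jap (ξ - η) ^ (-p)))
          ∂μH[(m : ℝ)] := by
        apply lintegral_mono
        intro ξ
        simp only
        rw [← ENNReal.ofReal_add (hj _) (hj _), ← ENNReal.ofReal_mul (by positivity)]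
        exact ENNReal.ofReal_le_ofReal (jap_weight β p hβ hp η ξ)
    _ = ENNReal.ofReal (2 ^ (2 * β) * jap η ^ (-(2 * β))) *
          ((∫⁻ ξ in sphere c R, ENNReal.ofReal (jap (ξ - 0) ^ (-p)) ∂μH[(m : ℝ)]) +
          ∫⁻ ξ in sphere c R, ENNReal.ofReal (jap (ξ - η) ^ (-p)) ∂μH[(m : ℝ)]) := by
        rw [lintegral_const_mul' _ _ (by simp), lintegral_add_left hms]
    _ ≤ ENNReal.ofReal (2 ^ (2 * β) * jap η ^ (-(2 * β))) *
          (K * ENNReal.ofReal (R ^ ((m : ℝ) - p)) + K * ENNReal.ofReal (R ^ ((m : ℝ) - p))) :=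
        mul_le_mul_right (add_le_add (h R hR c 0) (h R hR c η)) _
    _ = _ := by
        rw [ENNReal.ofReal_mul (by positivity), ENNReal.ofReal_mul (by positivity)]
        ring

lemma cauchy_schwarz_sq {n : ℕ} (μ : Measure (En n)) (f h : En n → ℝ≥0∞)
    (hf : AEMeasurable f μ) (hh : AEMeasurable h μ) :
    (∫⁻ x, f x * h x ∂μ) ^ 2 ≤ (∫⁻ x, f x ^ 2 ∂μ) * ∫⁻ x, h x ^ 2 ∂μ := by
  have := ENNReal.lintegral_mul_le_Lp_mul_Lq μ Real.HolderConjugate.two_two hf hh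
  calc (∫⁻ x, f x * h x ∂μ) ^ 2 ≤ ((∫⁻ x, f x ^ (2:ℝ) ∂μ) ^ (1 / (2:ℝ)) *
        (∫⁻ x, h x ^ (2:ℝ) ∂μ) ^ (1 / (2:ℝ))) ^ 2 := by gcongr; exact this
    _ = _ := by
      rw [mul_pow, ← ENNReal.rpow_natCast, ← ENNReal.rpow_natCast, ← ENNReal.rpow_mul,
        ← ENNReal.rpow_mul]
      norm_num

lemma sphere_integral_le (m : ℕ) (hm : 1 ≤ m) (β p : ℝ) (hβ : 0 ≤ β) (hp0 : 0 ≤ p) (hpm : p < m)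
    (hp : p ≤ 2 * β) :
    ∃ K : ℝ≥0∞, K ≠ ⊤ ∧ ∀ (q g : 𝓢(En (m + 1), ℂ)),
      (∀ ξ, g ξ = (jap ξ ^ β : ℝ) • 𝓕 (⇑q) ξ) → ∀ R : ℝ, 0 < R → ∀ c η : En (m + 1),
      ‖∫ ξ in sphere c R, 𝓕 (⇑q) ξ * 𝓕 (⇑q) (η - ξ) ∂μH[(m : ℝ)]‖ₑ ^ 2
        ≤ K * ENNReal.ofReal (jap η ^ (-(2 * β)) * R ^ ((m : ℝ) - p)) * Bmaj g η := by
  obtain ⟨K, hK, h⟩ := sphere_weight m hm β p hβ hp0 hpm hp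
  refine ⟨K, hK, ?_⟩
  intro q g hg R hR c η
  have hjm : Measurable (jap (n := m + 1)) := continuous_jap.measurable
  have hgm : Measurable g := g.continuous.measurable
  have hq : ∀ ξ, ‖𝓕 (⇑q) ξ‖ₑ = ENNReal.ofReal (jap ξ ^ (-β)) * ‖g ξ‖ₑ := by
    intro ξ
    have hj := jap_pos ξ
    rw [hg, enorm_smul, Real.enorm_eq_ofReal (by positivity), ← mul_assoc,
      ← ENNReal.ofReal_mul (by positivity), ← Real.rpow_add hj]
    simp
  set f1 : En (m + 1) → ℝ≥0∞ := fun ξ =>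
    ENNReal.ofReal (jap ξ ^ (-β)) * ENNReal.ofReal (jap (η - ξ) ^ (-β)) with hf1
  set f2 : En (m + 1) → ℝ≥0∞ := fun ξ => ‖g ξ‖ₑ * ‖g (η - ξ)‖ₑ with hf2
  have hm1 : Measurable f1 := by rw [hf1]; fun_prop
  have hm2 : Measurable f2 := by rw [hf2]; fun_prop
  have e1 : ∀ ξ, f1 ξ ^ 2 = ENNReal.ofReal (jap ξ ^ (-(2 * β)) * jap (η - ξ) ^ (-(2 * β))) := by
    intro ξ
    have hj := jap_pos ξ
    have hj' := jap_pos (η - ξ)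
    simp only [hf1]
    rw [← ENNReal.ofReal_mul (by positivity), ← ENNReal.ofReal_pow (by positivity), mul_pow,
      ← Real.rpow_natCast, ← Real.rpow_natCast, ← Real.rpow_mul hj.le, ← Real.rpow_mul hj'.le]
    congr 3 <;> · push_cast; ring
  have e2 : ∀ ξ, f2 ξ ^ 2 = ‖g ξ‖ₑ ^ 2 * ‖g (η - ξ)‖ₑ ^ 2 := fun ξ => mul_pow _ _ _
  calc ‖∫ ξ in sphere c R, 𝓕 (⇑q) ξ * 𝓕 (⇑q) (η - ξ) ∂μH[(m : ℝ)]‖ₑ ^ 2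
      ≤ (∫⁻ ξ in sphere c R, ‖𝓕 (⇑q) ξ * 𝓕 (⇑q) (η - ξ)‖ₑ ∂μH[(m : ℝ)]) ^ 2 := by
        gcongr
        exact enorm_integral_le_lintegral_enorm _
    _ = (∫⁻ ξ in sphere c R, f1 ξ * f2 ξ ∂μH[(m : ℝ)]) ^ 2 := by
        congr 2
        funext ξ
        rw [enorm_mul, hq, hq, hf1, hf2]
        ring
    _ ≤ (∫⁻ ξ in sphere c R, f1 ξ ^ 2 ∂μH[(m : ℝ)]) * ∫⁻ ξ in sphere c R, f2 ξ ^ 2 ∂μH[(m : ℝ)] :=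
        cauchy_schwarz_sq _ _ _ hm1.aemeasurable hm2.aemeasurable
    _ ≤ _ := by
        simp only [e1, e2]
        exact mul_le_mul' (h R hR c η) (lintegral_sphere_conv_le g η c R hR)

lemma exponent_bound (α β ε s r k j : ℝ) (hs : 0 ≤ s) (hr : 0 < r) (hj : 1 ≤ j)
    (hkj : j / 2 ≤ k) (hE : 2 * ε - 2 + s ≤ 0) (hE2 : 2 * α - 2 * β + (2 * ε - 2 + s) ≤ 0) :
    j ^ (2 * α) * (k ^ ε * (k * (r + 1))⁻¹) ^ 2 * (j ^ (-(2 * β)) * (r * k) ^ s) ≤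
      2 ^ (-(2 * ε - 2 + s)) * (1 + r) ^ (s - 2) := by
  have hj0 : 0 < j := by linarith
  have hk : 0 < k := by linarith
  have h1r : 0 < 1 + r := by linarith
  have h1 : (k ^ ε * (k * (r + 1))⁻¹) ^ 2 = k ^ (2 * ε) * k ^ (-2 : ℝ) * (1 + r) ^ (-2 : ℝ) := by
    rw [Real.rpow_neg hk.le, Real.rpow_neg h1r.le, mul_comm 2 ε, Real.rpow_mul hk.le]
    norm_num
    rw [mul_pow, mul_pow, inv_pow, inv_pow, add_comm r 1]
    ring
  have h2 : k ^ (2 * ε - 2 + s) ≤ 2 ^ (-(2 * ε - 2 + s)) * j ^ (2 * ε - 2 + s) := by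
    have := Real.rpow_le_rpow_of_nonpos (by positivity) hkj hE
    refine this.trans (le_of_eq ?_)
    rw [Real.div_rpow hj0.le (by norm_num), Real.rpow_neg (by norm_num), div_eq_mul_inv, mul_comm]
  have h3 : r ^ s ≤ (1 + r) ^ s := Real.rpow_le_rpow hr.le (by linarith) hs
  have h4 : j ^ (2 * α - 2 * β + (2 * ε - 2 + s)) ≤ 1 := Real.rpow_le_one_of_one_le_of_nonpos hj hE2
  calc j ^ (2 * α) * (k ^ ε * (k * (r + 1))⁻¹) ^ 2 * (j ^ (-(2 * β)) * (r * k) ^ s)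
      = j ^ (2 * α - 2 * β) * k ^ (2 * ε - 2 + s) * (r ^ s * (1 + r) ^ (-2 : ℝ)) := by
        rw [h1, Real.mul_rpow hr.le hk.le, sub_eq_add_neg (2 * α), Real.rpow_add hj0,
          sub_eq_add_neg (2 * ε), Real.rpow_add hk, Real.rpow_add hk]
        ring
    _ ≤ j ^ (2 * α - 2 * β) * (2 ^ (-(2 * ε - 2 + s)) * j ^ (2 * ε - 2 + s)) *
          ((1 + r) ^ s * (1 + r) ^ (-2 : ℝ)) := by gcongr
    _ = 2 ^ (-(2 * ε - 2 + s)) * j ^ (2 * α - 2 * β + (2 * ε - 2 + s)) * (1 + r) ^ (s - 2) := by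
        rw [Real.rpow_add hj0 (2 * α - 2 * β), sub_eq_add_neg s, Real.rpow_add h1r]
        ring
    _ ≤ 2 ^ (-(2 * ε - 2 + s)) * 1 * (1 + r) ^ (s - 2) := by gcongr
    _ = _ := by ring

lemma kval_ge {n : ℕ} (θ η : En n) (hθ : ‖θ‖ = 1) (h : ⟪η, θ⟫ < 0) : ‖η‖ ≤ kval θ η := by
  unfold kval
  rw [real_inner_comm] at h
  have h1 := abs_real_inner_le_norm θ η
  rw [hθ, one_mul, abs_of_neg h] at h1
  rw [le_div_iff_of_neg h]
  nlinarith [norm_nonneg η]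

lemma exists_p (m ε α β : ℝ) (hm : 1 ≤ m) (hβ : 0 ≤ β) (hε0 : 0 ≤ ε) (hε1 : ε < 1)
    (hα : ((m - 2) / 2 + ε < β ∧ β < m / 2 ∧ α ≤ 2 * β - (m - 2) / 2 - ε) ∨
          (m / 2 ≤ β ∧ α < β + 1 - ε)) :
    ∃ p : ℝ, 0 ≤ p ∧ p < m ∧ p ≤ 2 * β ∧ 2 * ε - 2 + (m - p) ≤ 0 ∧
      2 * α - 2 * β + (2 * ε - 2 + (m - p)) ≤ 0 ∧ m - p < 2 := by
  rcases hα with ⟨h1, h2, h3⟩ | ⟨h1, h2⟩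
  · exact ⟨2 * β, by linarith, by linarith, le_rfl, by linarith, by linarith, by linarith⟩
  · set τ := min (min (2 - 2 * ε) (2 + 2 * β - 2 * α - 2 * ε)) m / 2 with hτ
    have t0 : 0 < τ := by
      have : 0 < min (min (2 - 2 * ε) (2 + 2 * β - 2 * α - 2 * ε)) m :=
        lt_min (lt_min (by linarith) (by linarith)) (by linarith)
      positivity
    have t1 : 2 * τ ≤ 2 - 2 * ε := by
      have := (min_le_left _ m).trans (min_le_left (2 - 2 * ε) (2 + 2 * β - 2 * α - 2 * ε))
      linarith
    have t2 : 2 * τ ≤ 2 + 2 * β - 2 * α - 2 * ε := by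
      have := (min_le_left _ m).trans (min_le_right (2 - 2 * ε) (2 + 2 * β - 2 * α - 2 * ε))
      linarith
    have t3 : 2 * τ ≤ m := by
      have := min_le_right (min (2 - 2 * ε) (2 + 2 * β - 2 * α - 2 * ε)) m
      linarith
    exact ⟨m - τ, by linarith, by linarith, by linarith, by linarith, by linarith, by linarith⟩

/-- Estimate for the spherical operator (Lemma 3.1):
`‖k^ε S̃_{θ,r}(q)‖_{L²_α} ≤ C (1+r)^{-γ} ‖q‖²_{W^{β,2}_1}`. -/
theorem spherical_operator_weighted_L2_estimate (n : ℕ) (hn : 2 ≤ n) (β ε C₀ α : ℝ)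
    (hβ : 0 ≤ β) (hε0 : 0 ≤ ε) (hε1 : ε < 1) (hC₀ : 1 < C₀)
    (χ : En n → ℝ) (hχ : IsCutoff C₀ χ)
    (hα : (((n : ℝ) - 3) / 2 + ε < β ∧ β < ((n : ℝ) - 1) / 2 ∧
            α ≤ 2 * β - ((n : ℝ) - 3) / 2 - ε) ∨
          (((n : ℝ) - 1) / 2 ≤ β ∧ α < β + 1 - ε)) :
    ∃ C : ℝ, 0 < C ∧ ∃ γ : ℝ, 0 < γ ∧
      ∀ θ : En n, ‖θ‖ = 1 → ∀ r : ℝ, 0 < r → ∀ q : 𝓢(En n, ℂ),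
        L2w α (fun η => if ⟪η, θ⟫ < 0 then
            (kval θ η ^ ε * χ η) • Sop θ r ⇑q η else 0)
          ≤ C * (1 + r) ^ (-γ) * sobNorm β 1 ⇑q ^ 2 := by
  obtain ⟨m, rfl⟩ : ∃ m, n = m + 1 := ⟨n - 1, by omega⟩
  have hm : 1 ≤ m := by omega
  have hmR : (1 : ℝ) ≤ m := by exact_mod_cast hm
  have hcast : ((m + 1 : ℕ) : ℝ) - 1 = m := by push_cast; ring
  have hcast3 : ((m + 1 : ℕ) : ℝ) - 3 = m - 2 := by push_cast; ring
  rw [hcast, hcast3] at hα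
  obtain ⟨p, hp0, hpm, hpβ, hE, hE2, hp2⟩ := exists_p m ε α β hmR hβ hε0 hε1 hα
  obtain ⟨K, hK, hmain⟩ := sphere_integral_le m hm β p hβ hp0 hpm hpβ
  set s : ℝ := (m : ℝ) - p with hs
  have hs0 : 0 ≤ s := by rw [hs]; linarith
  set E : ℝ := 2 ^ (-(2 * ε - 2 + s)) with hEdef
  have hEpos : 0 < E := by rw [hEdef]; positivity
  set K2 : ℝ≥0∞ := ∑ _a : Fin (m + 1) × Bool,
    (Lc m : ℝ≥0∞) ^ m * (2 * (1 + ENNReal.ofReal ((2 * π) ^ 2))) with hK2def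
  have hK2 : K2 ≠ ⊤ := by
    refine (ENNReal.sum_lt_top.2 fun a _ => ?_).ne
    exact ENNReal.mul_lt_top (ENNReal.pow_lt_top ENNReal.coe_lt_top)
      (ENNReal.mul_lt_top (by simp) (by simp [ENNReal.add_lt_top]))
  set Q : ℝ := K.toReal * E * K2.toReal with hQ
  have hQ0 : 0 ≤ Q := by positivity
  refine ⟨(Q + 1) ^ (1 / 2 : ℝ), by positivity, (2 - s) / 2, by linarith, ?_⟩
  intro θ hθ r hr q
  obtain ⟨g, hg⟩ := exists_schwartz_weight β q
  obtain ⟨hP0, hP1⟩ := plancherel_bounds β q g hg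
  set N : ℝ := sobNorm β 1 (⇑q) with hN
  have h1r : 0 < 1 + r := by linarith
  have hB := lintegral_Bmaj_le g _ _ hP0 hP1
  rw [← hK2def] at hB
  have hpt : ∀ η : En (m + 1), ENNReal.ofReal (jap η ^ (2 * α) *
      ‖(if ⟪η, θ⟫ < 0 then (kval θ η ^ ε * χ η) • Sop θ r (⇑q) η else 0 : ℂ)‖ ^ 2) ≤
      (K * ENNReal.ofReal (E * (1 + r) ^ (s - 2))) * Bmaj g η := by
    intro η
    by_cases h : ⟪η, θ⟫ < 0
    swap
    · simp [h]
    by_cases hη : ‖η‖ < C₀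
    · simp [hχ.eq_zero η hη]
    push Not at hη
    have hj1 := one_le_jap η
    have hjp := jap_pos η
    have hk1 := kval_ge θ η hθ h
    have hkj : jap η / 2 ≤ kval θ η := by
      have : jap η ≤ 2 * ‖η‖ := by
        refine le_of_sq_le_sq ?_ (by positivity)
        rw [jap_sq]
        nlinarith
      linarith
    set k : ℝ := kval θ η with hk
    have hkpos : 0 < k := by linarith
    rw [if_pos h]
    unfold Sop
    rw [if_pos h, hcast, ← hk]
    unfold ewald
    rw [← hk]
    set I : ℂ := ∫ ξ in sphere (-(k • θ)) (r * k), 𝓕 (⇑q) ξ * 𝓕 (⇑q) (η - ξ) ∂μH[(m : ℝ)] with hI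
    have hmI := hmain q g hg (r * k) (by positivity) (-(k • θ)) η
    rw [← hI] at hmI
    have hχη := hχ.mem_Icc η
    have hn : ‖(k ^ ε * χ η) • ((k * (r + 1))⁻¹ : ℝ) • I‖ ≤
        (k ^ ε * (k * (r + 1))⁻¹) * ‖I‖ := by
      rw [norm_smul, norm_smul, Real.norm_of_nonneg (mul_nonneg (by positivity) hχη.1),
        Real.norm_of_nonneg (by positivity), ← mul_assoc]
      gcongr
      exact mul_le_of_le_one_right (by positivity) hχη.2
    have hb := exponent_bound α β ε s r k (jap η) hs0 hr hj1 hkj hE hE2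
    calc ENNReal.ofReal (jap η ^ (2 * α) * ‖(k ^ ε * χ η) • ((k * (r + 1))⁻¹ : ℝ) • I‖ ^ 2)
        ≤ ENNReal.ofReal (jap η ^ (2 * α) * ((k ^ ε * (k * (r + 1))⁻¹) * ‖I‖) ^ 2) := by
          apply ENNReal.ofReal_le_ofReal
          gcongr
      _ = ENNReal.ofReal (jap η ^ (2 * α) * (k ^ ε * (k * (r + 1))⁻¹) ^ 2) * ‖I‖ₑ ^ 2 := by
          rw [mul_pow, ← mul_assoc, ENNReal.ofReal_mul (by positivity),
            ENNReal.ofReal_pow (norm_nonneg _), ofReal_norm]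
      _ ≤ ENNReal.ofReal (jap η ^ (2 * α) * (k ^ ε * (k * (r + 1))⁻¹) ^ 2) *
            (K * ENNReal.ofReal (jap η ^ (-(2 * β)) * (r * k) ^ s) * Bmaj g η) := by
          gcongr
      _ = K * ENNReal.ofReal (jap η ^ (2 * α) * (k ^ ε * (k * (r + 1))⁻¹) ^ 2 *
            (jap η ^ (-(2 * β)) * (r * k) ^ s)) * Bmaj g η := by
          rw [ENNReal.ofReal_mul (p := jap η ^ (2 * α) * (k ^ ε * (k * (r + 1))⁻¹) ^ 2)
            (by positivity)]
          ring
      _ ≤ _ := by gcongr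
  set f : En (m + 1) → ℝ := fun η => jap η ^ (2 * α) *
      ‖(if ⟪η, θ⟫ < 0 then (kval θ η ^ ε * χ η) • Sop θ r (⇑q) η else 0 : ℂ)‖ ^ 2 with hf
  have hf0 : ∀ η, 0 ≤ f η := by
    intro η
    have := jap_pos η
    simp only [hf]
    positivity
  have hlin : ∫⁻ η, ENNReal.ofReal (f η) ≤
      ENNReal.ofReal (Q * (1 + r) ^ (s - 2) * (N ^ 2) ^ 2) := by
    calc ∫⁻ η, ENNReal.ofReal (f η)
        ≤ ∫⁻ η, (K * ENNReal.ofReal (E * (1 + r) ^ (s - 2))) * Bmaj g η := lintegral_mono hpt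
      _ = (K * ENNReal.ofReal (E * (1 + r) ^ (s - 2))) * ∫⁻ η, Bmaj g η :=
          lintegral_const_mul' _ _ (ENNReal.mul_ne_top hK (by simp))
      _ ≤ (K * ENNReal.ofReal (E * (1 + r) ^ (s - 2))) * (K2 * ENNReal.ofReal (N ^ 2) ^ 2) := by
          gcongr
      _ = (ENNReal.ofReal K.toReal * ENNReal.ofReal (E * (1 + r) ^ (s - 2))) *
            (ENNReal.ofReal K2.toReal * ENNReal.ofReal (N ^ 2) ^ 2) := by
          rw [ENNReal.ofReal_toReal hK, ENNReal.ofReal_toReal hK2]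
      _ = _ := by
          rw [← ENNReal.ofReal_pow (by positivity), ← ENNReal.ofReal_mul (by positivity),
            ← ENNReal.ofReal_mul (by positivity), ← ENNReal.ofReal_mul (by positivity)]
          congr 1
          rw [hQ]; ring
  have hfint : ∫ η, f η ≤ Q * (1 + r) ^ (s - 2) * (N ^ 2) ^ 2 := by
    by_cases hfi : Integrable f
    · rw [← ofReal_integral_eq_lintegral_ofReal hfi (Eventually.of_forall hf0)] at hlin
      exact (ENNReal.ofReal_le_ofReal_iff (by positivity)).1 hlin
    · rw [integral_undef hfi]; positivity
  have hfinal : L2w α (fun η => if ⟪η, θ⟫ < 0 then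
      (kval θ η ^ ε * χ η) • Sop θ r (⇑q) η else 0) = (∫ η, f η) ^ (1 / 2 : ℝ) := rfl
  rw [hfinal]
  calc (∫ η, f η) ^ (1 / 2 : ℝ) ≤ ((Q + 1) * (1 + r) ^ (s - 2) * (N ^ 2) ^ 2) ^ (1 / 2 : ℝ) := by
        apply Real.rpow_le_rpow (integral_nonneg hf0) _ (by norm_num)
        refine hfint.trans ?_
        gcongr
        linarith
    _ = _ := by
        rw [Real.mul_rpow (by positivity) (by positivity),
          Real.mul_rpow (by positivity) (by positivity), ← Real.rpow_mul h1r.le,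
          ← Real.rpow_natCast (N ^ 2) 2, ← Real.rpow_mul (by positivity)]
        rw [show (s - 2) * (1 / 2) = -((2 - s) / 2) by ring,
          show ((2 : ℕ) : ℝ) * (1 / 2) = 1 by norm_num, Real.rpow_one]

end
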